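/- Let Γ₇ = {ξ : ℤ/7ℤ → ℤ : ξ_k ≤ 1 for all k}, and for bounded f : Γ₇ → ℝ define (L f)(ξ) = Σ_{k ∈ ℤ/7ℤ} Σ_{z ∈ {−1,1}} 1{ξ_k = 1 and ξ_{k+z} ≤ 0} (f(ξ^{k,k+z}) − f(ξ)). Then sup|Lf| ≤ 28 sup|f|, so for every bounded f and every t ≥ 0 the series (P_t f)(ξ) = Σ_{n≥0} (t^n/n!) (L^n f)(ξ) converges absolutely. Let ξ⁰ ∈ Γ₇ with (ξ⁰_1,…,ξ⁰_7) = (−3, 1, 1, 1, 0, −1, 0), and let f(ξ) = 1{ξ_6 = 1}, g(ξ) = 1{ξ_7 = 1}, h = f·g. Then there exists δ > 0 such that for every 0 < t < δ, (P_t h)(ξ⁰) > (P_t f)(ξ⁰) · (P_t g)(ξ⁰). -/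

import Mathlib

/-- The SWT configuration after the particle at site `k` jumps to site `k + z`. -/
def swtJumpConfig (ξ : ZMod 7 → ℤ) (k z : ZMod 7) : ZMod 7 → ℤ :=
  fun k' => if k' = k then 0 else if k' = k + z then ξ (k + z) + 1 else ξ k'

/-- The Markov generator of the SSEP with traps on `ℤ/7ℤ`:
`(L f)(ξ) = Σ_{k} Σ_{z = ±1} 1{ξ k = 1, ξ (k+z) ≤ 0} (f (ξ^{k,k+z}) - f ξ)`. -/
noncomputable def swtGen (f : (ZMod 7 → ℤ) → ℝ) : (ZMod 7 → ℤ) → ℝ :=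
  fun ξ => ∑ k : ZMod 7,
    ((if ξ k = 1 ∧ ξ (k + 1) ≤ 0 then f (swtJumpConfig ξ k 1) - f ξ else 0) +
      (if ξ k = 1 ∧ ξ (k + -1) ≤ 0 then f (swtJumpConfig ξ k (-1)) - f ξ else 0))

/-- The semigroup `P_t = e^{t L}` of the SSEP with traps on `ℤ/7ℤ`, defined through the
exponential series `(P_t f)(ξ) = Σ_{n ≥ 0} (tⁿ/n!) (Lⁿ f)(ξ)`. -/
noncomputable def swtSemigroup (t : ℝ) (f : (ZMod 7 → ℤ) → ℝ) (ξ : ZMod 7 → ℤ) : ℝ :=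
  ∑' n : ℕ, t ^ n / (n.factorial : ℝ) * (swtGen^[n] f) ξ

/-- The configuration `(-3, 1, 1, 1, 0, -1, 0)` on `ℤ/7ℤ` (sites `1, …, 7`, with `7 = 0`). -/
def swtXi0 : ZMod 7 → ℤ :=
  fun k => if k = 1 then -3 else if k = 2 then 1 else if k = 3 then 1 else
    if k = 4 then 1 else if k = 5 then 0 else if k = 6 then -1 else 0

/-- The jump of a live particle from site `k` to site `k + z` is allowed in `ξ`. -/
def SwtAllowed (ξ : ZMod 7 → ℤ) (k z : ZMod 7) : Prop :=
  (z = 1 ∨ z = -1) ∧ ξ k = 1 ∧ ξ (k + z) ≤ 0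

/-- A jump-invariant set of configurations containing `swtXi0`. -/
structure SwtInvariant (ξ : ZMod 7 → ℤ) : Prop where
  total : ξ 0 + ξ 1 + ξ 2 + ξ 3 + ξ 4 + ξ 5 + ξ 6 = -1
  site_zero : 0 ≤ ξ 0 ∧ ξ 0 ≤ 1
  site_one : -3 ≤ ξ 1
  site_two : 0 ≤ ξ 2 ∧ ξ 2 ≤ 1
  site_three : 0 ≤ ξ 3 ∧ ξ 3 ≤ 1
  site_four : 0 ≤ ξ 4 ∧ ξ 4 ≤ 1
  site_five : 0 ≤ ξ 5 ∧ ξ 5 ≤ 1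
  site_six : -1 ≤ ξ 6 ∧ ξ 6 ≤ 1
  trap_blocks : ξ 6 < 0 → ξ 0 ≤ 0

/-- A weighted particle count which increases by at most one per jump on `SwtInvariant`. -/
def swtPotential (ξ : ZMod 7 → ℤ) : ℤ :=
  7 * ξ 0 + 3 * ξ 1 + 2 * ξ 2 + 3 * ξ 3 + 4 * ξ 4 + 5 * ξ 5 + 6 * ξ 6

theorem swtInvariant_xi0 : SwtInvariant swtXi0 := by
  constructor <;> decide

theorem swtPotential_xi0 : swtPotential swtXi0 = -6 := by decide

theorem SwtInvariant.jump {ξ : ZMod 7 → ℤ} (hξ : SwtInvariant ξ) {k z : ZMod 7}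
    (h : SwtAllowed ξ k z) :
    SwtInvariant (swtJumpConfig ξ k z) ∧
      swtPotential (swtJumpConfig ξ k z) ≤ swtPotential ξ + 1 := by
  obtain ⟨hs, h0, h1, h2, h3, h4, h5, h6, hb⟩ := hξ
  obtain ⟨hz, hk, hkz⟩ := h
  suffices H : ∀ c : ZMod 7, c = k + z → SwtInvariant (fun k' =>
      if k' = k then 0 else if k' = c then ξ c + 1 else ξ k') ∧
      swtPotential (fun k' => if k' = k then 0 else if k' = c then ξ c + 1 else ξ k') ≤
        swtPotential ξ + 1 from H _ rfl
  intro c hc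
  rw [← hc] at hkz
  have cases_k : k = 0 ∨ k = 1 ∨ k = 2 ∨ k = 3 ∨ k = 4 ∨ k = 5 ∨ k = 6 := by
    have all : ∀ j : ZMod 7, j = 0 ∨ j = 1 ∨ j = 2 ∨ j = 3 ∨ j = 4 ∨ j = 5 ∨ j = 6 := by
      decide
    exact all k
  rcases cases_k with rfl | rfl | rfl | rfl | rfl | rfl | rfl <;> rcases hz with rfl | rfl <;>
    [have e : c = 1 := hc; have e : c = 6 := hc; have e : c = 2 := hc; have e : c = 0 := hc;
     have e : c = 3 := hc; have e : c = 1 := hc; have e : c = 4 := hc; have e : c = 2 := hc;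
     have e : c = 5 := hc; have e : c = 3 := hc; have e : c = 6 := hc; have e : c = 4 := hc;
     have e : c = 0 := hc; have e : c = 5 := hc] <;>
    subst e <;> clear hc <;>
    refine ⟨⟨?_, ?_, ?_, ?_, ?_, ?_, ?_, ?_, ?_⟩, ?_⟩ <;>
    simp +decide only [swtPotential, if_true, if_false] <;> (first | omega | exact False.elim)

theorem abs_swtGen_le (f : (ZMod 7 → ℤ) → ℝ) (M : ℝ) (hf : ∀ ξ, |f ξ| ≤ M) (ξ : ZMod 7 → ℤ) :
    |swtGen f ξ| ≤ 28 * M := by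
  have hM : 0 ≤ M := (abs_nonneg _).trans (hf ξ)
  have term (p : Prop) [Decidable p] (η : ZMod 7 → ℤ) :
      |if p then f η - f ξ else 0| ≤ 2 * M := by
    split_ifs
    · exact (abs_sub _ _).trans (by linarith [hf η, hf ξ])
    · simpa using hM
  calc |swtGen f ξ| ≤ ∑ _k : ZMod 7, (4 * M) := by
        refine (Finset.abs_sum_le_sum_abs _ _).trans (Finset.sum_le_sum fun k _ => ?_)
        have right := term (ξ k = 1 ∧ ξ (k + 1) ≤ 0) (swtJumpConfig ξ k 1)
        have left := term (ξ k = 1 ∧ ξ (k + -1) ≤ 0) (swtJumpConfig ξ k (-1))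
        exact (abs_add_le _ _).trans (by linarith)
    _ = 28 * M := by
        rw [Finset.sum_const, Finset.card_univ, ZMod.card, nsmul_eq_mul]
        push_cast
        ring

theorem abs_swtGen_iterate_le (f : (ZMod 7 → ℤ) → ℝ) (M : ℝ) (hf : ∀ ξ, |f ξ| ≤ M) (n : ℕ) :
    ∀ ξ, |(swtGen^[n] f) ξ| ≤ 28 ^ n * M := by
  induction n with
  | zero => simpa using hf
  | succ n ih =>
    intro ξ
    rw [Function.iterate_succ_apply', pow_succ', mul_assoc]
    exact abs_swtGen_le _ _ ih ξ

theorem abs_swtSemigroup_term_le (f : (ZMod 7 → ℤ) → ℝ) (M : ℝ) (hf : ∀ ξ, |f ξ| ≤ M)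
    {t : ℝ} (ht : 0 ≤ t) (ξ : ZMod 7 → ℤ) (n : ℕ) :
    |t ^ n / (n.factorial : ℝ) * (swtGen^[n] f) ξ| ≤
      t ^ n / (n.factorial : ℝ) * (28 ^ n * M) := by
  have h : 0 ≤ t ^ n / (n.factorial : ℝ) := by positivity
  rw [abs_mul, abs_of_nonneg h]
  exact mul_le_mul_of_nonneg_left (abs_swtGen_iterate_le f M hf n ξ) h

theorem summable_abs_swtSemigroup (f : (ZMod 7 → ℤ) → ℝ) (M : ℝ) (hf : ∀ ξ, |f ξ| ≤ M)
    (t : ℝ) (ht : 0 ≤ t) (ξ : ZMod 7 → ℤ) :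
    Summable (fun n : ℕ => |t ^ n / (n.factorial : ℝ) * (swtGen^[n] f) ξ|) := by
  refine Summable.of_nonneg_of_le (fun _ => abs_nonneg _)
    (abs_swtSemigroup_term_le f M hf ht ξ)
    (((Real.summable_pow_div_factorial (28 * t)).mul_left M).congr fun n => ?_)
  rw [mul_pow]
  ring

/-- Taylor remainder estimate for the semigroup acting on functions bounded by one. -/
theorem abs_swtSemigroup_sub_le (f : (ZMod 7 → ℤ) → ℝ) (hf : ∀ ξ, |f ξ| ≤ 1)
    {t : ℝ} (ht : 0 ≤ t) (ht1 : t ≤ 1) (ξ : ZMod 7 → ℤ) (m : ℕ) :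
    |swtSemigroup t f ξ -
        ∑ n ∈ Finset.range m, t ^ n / (n.factorial : ℝ) * (swtGen^[n] f) ξ| ≤
      t ^ m * Real.exp 28 := by
  have hs := summable_abs_swtSemigroup f 1 hf t ht ξ
  have hexp : Real.exp 28 = ∑' n : ℕ, (28 : ℝ) ^ n / (n.factorial : ℝ) := by
    rw [Real.exp_eq_exp_ℝ, NormedSpace.exp_eq_tsum_div]
  have hE := Real.summable_pow_div_factorial 28
  rw [swtSemigroup, ← hs.of_abs.sum_add_tsum_nat_add m, add_sub_cancel_left,
    ← Real.norm_eq_abs]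
  have hEm := (summable_nat_add_iff m).2 hE
  calc _ ≤ ∑' n : ℕ, t ^ m * ((28 : ℝ) ^ (n + m) / ((n + m).factorial : ℝ)) := by
        refine tsum_of_norm_bounded (hEm.mul_left _).hasSum fun n => ?_
        refine (abs_swtSemigroup_term_le f 1 hf ht ξ _).trans ?_
        have hpow : t ^ (n + m) ≤ t ^ m := pow_le_pow_of_le_one ht ht1 (Nat.le_add_left _ _)
        calc _ = t ^ (n + m) * ((28 : ℝ) ^ (n + m) / ((n + m).factorial : ℝ)) := by ring
          _ ≤ _ := mul_le_mul_of_nonneg_right hpow (by positivity)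
    _ = t ^ m * ∑' n : ℕ, (28 : ℝ) ^ (n + m) / ((n + m).factorial : ℝ) := tsum_mul_left
    _ ≤ t ^ m * Real.exp 28 := by
        refine mul_le_mul_of_nonneg_left ?_ (by positivity)
        rw [hexp, ← hE.sum_add_tsum_nat_add m]
        exact le_add_of_nonneg_left (Finset.sum_nonneg fun _ _ => by positivity)

/-- A function supported, within the invariant set, on potentials at least `c` is not seen by the
first iterates of the generator. -/
theorem swtGen_iterate_eq_zero {f : (ZMod 7 → ℤ) → ℝ} {c : ℤ}
    (hf : ∀ ξ, SwtInvariant ξ → swtPotential ξ < c → f ξ = 0) (n : ℕ) :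
    ∀ ξ, SwtInvariant ξ → swtPotential ξ + n < c → (swtGen^[n] f) ξ = 0 := by
  induction n with
  | zero => simpa using hf
  | succ n ih =>
    intro ξ hξ hc
    push_cast at hc
    have h0 := ih ξ hξ (by omega)
    have hj {k z : ZMod 7} (h : SwtAllowed ξ k z) :
        (swtGen^[n] f) (swtJumpConfig ξ k z) = 0 :=
      ih _ (hξ.jump h).1 (by linarith [(hξ.jump h).2])
    rw [Function.iterate_succ_apply']
    refine Finset.sum_eq_zero fun k _ => ?_
    have h1 (h : ξ k = 1 ∧ ξ (k + 1) ≤ 0) := hj ⟨Or.inl rfl, h⟩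
    have h2 (h : ξ k = 1 ∧ ξ (k + -1) ≤ 0) := hj ⟨Or.inr rfl, h⟩
    split_ifs <;> simp_all

theorem swtGen_iterate_nonneg {f : (ZMod 7 → ℤ) → ℝ} {c : ℤ} (hpos : ∀ ξ, 0 ≤ f ξ)
    (hf : ∀ ξ, SwtInvariant ξ → swtPotential ξ < c → f ξ = 0) (n : ℕ) :
    ∀ ξ, SwtInvariant ξ → swtPotential ξ + n ≤ c → 0 ≤ (swtGen^[n] f) ξ := by
  induction n with
  | zero => exact fun ξ _ _ => hpos ξ
  | succ n ih =>
    intro ξ hξ hc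
    push_cast at hc
    have h0 := swtGen_iterate_eq_zero hf n ξ hξ (by omega)
    have hj {k z : ZMod 7} (h : SwtAllowed ξ k z) :
        0 ≤ (swtGen^[n] f) (swtJumpConfig ξ k z) :=
      ih _ (hξ.jump h).1 (by linarith [(hξ.jump h).2])
    rw [Function.iterate_succ_apply']
    refine Finset.sum_nonneg fun k _ => ?_
    have h1 (h : ξ k = 1 ∧ ξ (k + 1) ≤ 0) := hj ⟨Or.inl rfl, h⟩
    have h2 (h : ξ k = 1 ∧ ξ (k + -1) ≤ 0) := hj ⟨Or.inr rfl, h⟩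
    rw [h0, sub_zero, sub_zero]
    exact add_nonneg (by split_ifs with h; exacts [h1 h, le_rfl])
      (by split_ifs with h; exacts [h2 h, le_rfl])

/-- A single allowed jump to the right bounds the iterated generator from below. -/
theorem le_swtGen_iterate_succ {f : (ZMod 7 → ℤ) → ℝ} {c : ℤ} (hpos : ∀ ξ, 0 ≤ f ξ)
    (hf : ∀ ξ, SwtInvariant ξ → swtPotential ξ < c → f ξ = 0) (n : ℕ) {ξ : ZMod 7 → ℤ}
    (hξ : SwtInvariant ξ) (hc : swtPotential ξ + (n + 1) ≤ c) {k : ZMod 7}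
    (hk : ξ k = 1 ∧ ξ (k + 1) ≤ 0) :
    (swtGen^[n] f) (swtJumpConfig ξ k 1) ≤ (swtGen^[n + 1] f) ξ := by
  have h0 := swtGen_iterate_eq_zero hf n ξ hξ (by omega)
  have hj {k z : ZMod 7} (h : SwtAllowed ξ k z) :
      0 ≤ (swtGen^[n] f) (swtJumpConfig ξ k z) :=
    swtGen_iterate_nonneg hpos hf n _ (hξ.jump h).1 (by linarith [(hξ.jump h).2])
  have h1 (k) (h : ξ k = 1 ∧ ξ (k + 1) ≤ 0) := hj ⟨Or.inl rfl, h⟩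
  have h2 (k) (h : ξ k = 1 ∧ ξ (k + -1) ≤ 0) := hj ⟨Or.inr rfl, h⟩
  rw [Function.iterate_succ_apply', swtGen]
  simp only [h0, sub_zero]
  have left (k : ZMod 7) : 0 ≤ if ξ k = 1 ∧ ξ (k + -1) ≤ 0 then
      (swtGen^[n] f) (swtJumpConfig ξ k (-1)) else 0 := by
    split_ifs with h
    exacts [h2 k h, le_rfl]
  have right (k : ZMod 7) : 0 ≤ if ξ k = 1 ∧ ξ (k + 1) ≤ 0 then
      (swtGen^[n] f) (swtJumpConfig ξ k 1) else 0 := by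
    split_ifs with h
    exacts [h1 k h, le_rfl]
  refine le_trans ?_ (Finset.single_le_sum (fun k _ => add_nonneg (right k) (left k))
    (Finset.mem_univ k))
  rw [if_pos hk]
  exact le_add_of_nonneg_right (left k)

/-- Successive jumps to the right from the listed sites are all allowed. -/
def SwtPath : (ZMod 7 → ℤ) → List (ZMod 7) → Prop
  | _, [] => True
  | ξ, k :: l => (ξ k = 1 ∧ ξ (k + 1) ≤ 0) ∧ SwtPath (swtJumpConfig ξ k 1) l

theorem SwtPath.le_swtGen_iterate {f : (ZMod 7 → ℤ) → ℝ} {c : ℤ} (hpos : ∀ ξ, 0 ≤ f ξ)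
    (hf : ∀ ξ, SwtInvariant ξ → swtPotential ξ < c → f ξ = 0) (l : List (ZMod 7)) :
    ∀ ξ, SwtPath ξ l → SwtInvariant ξ → swtPotential ξ + l.length ≤ c →
      f (l.foldl (fun η k => swtJumpConfig η k 1) ξ) ≤ (swtGen^[l.length] f) ξ := by
  induction l with
  | nil => exact fun ξ _ _ _ => le_rfl
  | cons k l ih =>
    intro ξ hl hξ hc
    rw [List.length_cons] at hc ⊢
    push_cast at hc
    have hj := hξ.jump (k := k) ⟨Or.inl rfl, hl.1⟩
    exact (ih _ hl.2 hj.1 (by linarith [hj.2])).trans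
      (le_swtGen_iterate_succ hpos hf _ hξ hc hl.1)

theorem abs_swtSemigroup_xi0_le {f : (ZMod 7 → ℤ) → ℝ} (hb : ∀ ξ, |f ξ| ≤ 1) (m : ℕ)
    (hf : ∀ ξ, SwtInvariant ξ → swtPotential ξ < m - 6 → f ξ = 0)
    {t : ℝ} (ht : 0 ≤ t) (ht1 : t ≤ 1) :
    |swtSemigroup t f swtXi0| ≤ t ^ m * Real.exp 28 := by
  have h := abs_swtSemigroup_sub_le f hb ht ht1 swtXi0 m
  rwa [Finset.sum_eq_zero, sub_zero] at h
  intro n hn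
  rw [swtGen_iterate_eq_zero hf n _ swtInvariant_xi0, mul_zero]
  have := Finset.mem_range.1 hn
  rw [swtPotential_xi0]
  omega

theorem le_swtSemigroup_both_xi0 {t : ℝ} (ht : 0 ≤ t) (ht1 : t ≤ 1) :
    t ^ 10 / (Nat.factorial 10 : ℝ) - t ^ 11 * Real.exp 28 ≤
      swtSemigroup t
        (fun ξ => (if ξ 6 = 1 then (1 : ℝ) else 0) * (if ξ 7 = 1 then 1 else 0)) swtXi0 := by
  set h : (ZMod 7 → ℤ) → ℝ :=
    fun ξ => (if ξ 6 = 1 then (1 : ℝ) else 0) * (if ξ 7 = 1 then 1 else 0) with h_def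
  have hpos (ξ) : 0 ≤ h ξ := by
    simp only [h_def]
    positivity
  have hb (ξ) : |h ξ| ≤ 1 := by
    simp only [h_def]
    split_ifs <;> simp
  have hf (ξ) (hξ : SwtInvariant ξ) (hV : swtPotential ξ < 4) : h ξ = 0 := by
    obtain ⟨hs, h0, h1, h2, h3, h4, h5, h6, hb⟩ := hξ
    have e7 : ξ 7 = ξ 0 := rfl
    have : ¬ (ξ 6 = 1 ∧ ξ 7 = 1) := by
      rintro ⟨a, b⟩
      simp only [swtPotential] at hV
      omega
    simp only [h_def]
    split_ifs <;> simp_all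
  have hpath := SwtPath.le_swtGen_iterate hpos hf [4, 5, 3, 4, 5, 6, 2, 3, 4, 5] swtXi0
    (by simp only [SwtPath]; decide) swtInvariant_xi0 (by decide)
  have hend : h ([4, 5, 3, 4, 5, 6, 2, 3, 4, 5].foldl (fun η k => swtJumpConfig η k 1) swtXi0)
      = 1 := by
    simp only [h_def]
    rw [if_pos (by decide), if_pos (by decide), one_mul]
  rw [hend] at hpath
  have hrem := (abs_le.1 (abs_swtSemigroup_sub_le h hb ht ht1 swtXi0 11)).1
  rw [Finset.sum_range_succ, Finset.sum_eq_zero, zero_add] at hrem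
  · have hcoef : t ^ 10 / (Nat.factorial 10 : ℝ) * 1 ≤
        t ^ 10 / (Nat.factorial 10 : ℝ) * (swtGen^[10] h) swtXi0 :=
      mul_le_mul_of_nonneg_left hpath (by positivity)
    linarith
  · intro n hn
    rw [swtGen_iterate_eq_zero hf n _ swtInvariant_xi0, mul_zero]
    have := Finset.mem_range.1 hn
    rw [swtPotential_xi0]
    omega

/-- absence of negative dependence for the SWT.
The generator `L` of the SSEP with traps on `ℤ/7ℤ` satisfies `sup |L f| ≤ 28 sup |f|`, so
for every bounded `f` and `t ≥ 0` the series `(P_t f)(ξ) = Σ_n (tⁿ/n!) (Lⁿ f)(ξ)`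
converges absolutely.  Moreover, with `ξ⁰ = (-3, 1, 1, 1, 0, -1, 0)`,
`f = 1{ξ 6 = 1}`, `g = 1{ξ 7 = 1}` and `h = f·g`, there is `δ > 0` such that
`(P_t h)(ξ⁰) > (P_t f)(ξ⁰) (P_t g)(ξ⁰)` for all `0 < t < δ`: the occupancies of sites
`6` and `7` become positively correlated. -/
theorem swt_not_negatively_dependent :
    (∀ (f : (ZMod 7 → ℤ) → ℝ) (M : ℝ), (∀ ξ, |f ξ| ≤ M) →
      ∀ ξ, |swtGen f ξ| ≤ 28 * M) ∧
    (∀ (f : (ZMod 7 → ℤ) → ℝ) (M : ℝ), (∀ ξ, |f ξ| ≤ M) → ∀ t : ℝ, 0 ≤ t → ∀ ξ,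
      Summable (fun n : ℕ => |t ^ n / (n.factorial : ℝ) * (swtGen^[n] f) ξ|)) ∧
    (∃ δ : ℝ, 0 < δ ∧ ∀ t : ℝ, 0 < t → t < δ →
      swtSemigroup t
          (fun ξ => (if ξ 6 = 1 then (1 : ℝ) else 0) * (if ξ 7 = 1 then 1 else 0))
          swtXi0
        > swtSemigroup t (fun ξ => if ξ 6 = 1 then (1 : ℝ) else 0) swtXi0
          * swtSemigroup t (fun ξ => if ξ 7 = 1 then (1 : ℝ) else 0) swtXi0) := by
  refine ⟨abs_swtGen_le, summable_abs_swtSemigroup, ?_⟩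
  set C := Real.exp 28
  have hC : 0 < C := Real.exp_pos _
  have hN : (0 : ℝ) < (Nat.factorial 10 : ℝ) := by positivity
  set D : ℝ := Nat.factorial 10 * (C + C ^ 2) with hD
  have hDpos : 0 < D := by positivity
  refine ⟨min 1 D⁻¹, by positivity, fun t ht hδ => ?_⟩
  have ht1 : t ≤ 1 := hδ.le.trans (min_le_left _ _)
  have htD : t * D < 1 := by
    rw [← inv_mul_cancel₀ hDpos.ne']
    exact mul_lt_mul_of_pos_right (hδ.trans_le (min_le_right _ _)) hDpos
  have hF := abs_swtSemigroup_xi0_le (f := fun ξ => if ξ 6 = 1 then (1 : ℝ) else 0)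
    (fun ξ => by split_ifs <;> simp) 5 (fun ξ ⟨hs, h0, h1, h2, h3, h4, h5, h6, hb⟩ hV => by
      simp only [swtPotential] at hV
      exact if_neg (by push_cast at hV; omega)) ht.le ht1
  have hG := abs_swtSemigroup_xi0_le (f := fun ξ => if ξ 7 = 1 then (1 : ℝ) else 0)
    (fun ξ => by split_ifs <;> simp) 6 (fun ξ ⟨hs, h0, h1, h2, h3, h4, h5, h6, hb⟩ hV => by
      have e7 : ξ 7 = ξ 0 := rfl
      simp only [swtPotential] at hV
      exact if_neg (by push_cast at hV; omega)) ht.le ht1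
  have hH := le_swtSemigroup_both_xi0 ht.le ht1
  refine lt_of_lt_of_le ?_ hH
  calc _ ≤ |_| := le_abs_self _
    _ ≤ (t ^ 5 * C) * (t ^ 6 * C) := by
        rw [abs_mul]
        exact mul_le_mul hF hG (abs_nonneg _) (by positivity)
    _ < t ^ 10 / (Nat.factorial 10 : ℝ) - t ^ 11 * C := by
        rw [lt_sub_iff_add_lt, lt_div_iff₀ hN]
        calc _ = t ^ 10 * (t * D) := by rw [hD]; ring
          _ < t ^ 10 * 1 := mul_lt_mul_of_pos_left htD (by positivity)
          _ = t ^ 10 := mul_one _
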